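/- The sum c := Σ_{L ∈ 𝐋} 2^{−(width(L)+height(L)+2)} over hitomezashi loops modulo translation converges, and as min{m,n} → ∞, the expected number of loops in H_{1/2}(m,n) satisfies E[Loops(H_{1/2}(m,n))] = (c + o(1))·mn. -/

import Mathlib

/-- A stitch is a unit segment of the grid: `vert i j` is the vertical segment from
`(i,j)` to `(i,j+1)`; `horiz i j` is the horizontal segment from `(i,j)` to `(i+1,j)`. -/
inductive Stitch : Type
  | vert : ℤ → ℤ → Stitch
  | horiz : ℤ → ℤ → Stitch
  deriving DecidableEq

/-- Membership of a stitch in the hitomezashi pattern with labels `ε` (vertical lines)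
and `η` (horizontal lines). -/
def Stitch.InPattern (ε η : ℤ → ZMod 2) : Stitch → Prop
  | .vert i j => (j : ZMod 2) = ε i
  | .horiz i j => (i : ZMod 2) = η j

/-- The stitch as a subset of the plane. -/
def Stitch.seg : Stitch → Set (ℝ × ℝ)
  | .vert i j => segment ℝ ((i : ℝ), (j : ℝ)) ((i : ℝ), (j : ℝ) + 1)
  | .horiz i j => segment ℝ ((i : ℝ), (j : ℝ)) ((i : ℝ) + 1, (j : ℝ))

/-- The union of the segments of a set of stitches. -/
def curveOf (S : Set Stitch) : Set (ℝ × ℝ) := ⋃ s ∈ S, s.seg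

/-- `C` is a simple closed curve: it is homeomorphic to a circle. -/
def IsCircle (C : Set (ℝ × ℝ)) : Prop :=
  Nonempty (C ≃ₜ Metric.sphere (0 : ℝ × ℝ) 1)

/-- The interior of a closed curve `C`: the union of the bounded connected
components of its complement. -/
def intOf (C : Set (ℝ × ℝ)) : Set (ℝ × ℝ) :=
  {p | p ∉ C ∧ Bornology.IsBounded (connectedComponentIn Cᶜ p)}

/-- The exterior of a closed curve `C`: the union of the unbounded connected
components of its complement. -/
def extOf (C : Set (ℝ × ℝ)) : Set (ℝ × ℝ) :=
  {p | p ∉ C ∧ ¬ Bornology.IsBounded (connectedComponentIn Cᶜ p)}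

/-- The open unit cell with southwest corner `(i,j)`. -/
def cell (i j : ℤ) : Set (ℝ × ℝ) :=
  Set.Ioo (i : ℝ) ((i : ℝ) + 1) ×ˢ Set.Ioo (j : ℝ) ((j : ℝ) + 1)

/-- A hitomezashi loop in the pattern with labels `ε`, `η`: a (finite) set of stitches
of the pattern whose union is a simple closed curve. -/
structure HLoop (ε η : ℤ → ZMod 2) where
  stitches : Finset Stitch
  inPattern : ∀ s ∈ stitches, s.InPattern ε η
  isCircle : IsCircle (curveOf ↑stitches)

/-- The stitch lies inside the `m × n` grid `[0,n] × [0,m]`. -/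
def Stitch.inGrid (m n : ℕ) : Stitch → Prop
  | .vert i j => 0 ≤ i ∧ i ≤ (n : ℤ) ∧ 0 ≤ j ∧ j + 1 ≤ (m : ℤ)
  | .horiz i j => 0 ≤ i ∧ i + 1 ≤ (n : ℤ) ∧ 0 ≤ j ∧ j ≤ (m : ℤ)

/-- The number of hitomezashi loops all of whose stitches are stitches of the
`m × n` hitomezashi pattern with labels `ε`, `η`. -/
noncomputable def LoopsCount (m n : ℕ) (ε η : ℤ → ZMod 2) : ℕ :=
  Nat.card {S : Finset Stitch // IsCircle (curveOf ↑S) ∧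
    ∀ s ∈ S, s.InPattern ε η ∧ s.inGrid m n}

/-- Extend labels on `{0, …, N}` to all of `ℤ` (by `0` outside; only the values on
`{0, …, N}` are relevant for stitches inside the grid). -/
def extendLabels (N : ℕ) (f : Fin (N+1) → ZMod 2) : ℤ → ZMod 2 :=
  fun i => if h : 0 ≤ i ∧ i ≤ (N : ℤ) then f ⟨i.toNat, by omega⟩ else 0

/-- The expected number of loops in the random `m × n` hitomezashi pattern whose
`m + n + 2` labels are independent and uniform on `{0,1}`. -/
noncomputable def ELoops (m n : ℕ) : ℝ :=
  (∑ f : Fin (n+1) → ZMod 2, ∑ g : Fin (m+1) → ZMod 2,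
    (LoopsCount m n (extendLabels n f) (extendLabels m g) : ℝ)) / 2 ^ (m + n + 2)

def Stitch.minX : Stitch → ℤ
  | .vert i _ => i
  | .horiz i _ => i

def Stitch.maxX : Stitch → ℤ
  | .vert i _ => i
  | .horiz i _ => i + 1

def Stitch.minY : Stitch → ℤ
  | .vert _ j => j
  | .horiz _ j => j

def Stitch.maxY : Stitch → ℤ
  | .vert _ j => j + 1
  | .horiz _ j => j

/-- The width of a finite set of stitches: difference between the maximal and minimal
x-coordinates of its points. -/
noncomputable def loopW (S : Finset Stitch) : ℤ :=
  sSup {x : ℤ | ∃ s ∈ S, x = s.maxX} - sInf {x : ℤ | ∃ s ∈ S, x = s.minX}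

/-- The height of a finite set of stitches: difference between the maximal and minimal
y-coordinates of its points. -/
noncomputable def loopH (S : Finset Stitch) : ℤ :=
  sSup {y : ℤ | ∃ s ∈ S, y = s.maxY} - sInf {y : ℤ | ∃ s ∈ S, y = s.minY}

/-- `S` is a hitomezashi loop normalized so that its minimal x- and y-coordinates are `0`.
Normalized loops are canonical representatives for the set `𝐋` of hitomezashi loops
modulo translation. -/
def IsNormLoop (S : Finset Stitch) : Prop :=
  (∃ ε η : ℤ → ZMod 2, ∀ s ∈ S, s.InPattern ε η) ∧
  IsCircle (curveOf ↑S) ∧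
  sInf {x : ℤ | ∃ s ∈ S, x = s.minX} = 0 ∧
  sInf {y : ℤ | ∃ s ∈ S, y = s.minY} = 0

/-- The constant `c = Σ_{L ∈ 𝐋} 2^{-(width(L)+height(L)+2)}`. -/
noncomputable def loopConst : ℝ :=
  ∑' S : {S : Finset Stitch // IsNormLoop S}, (2 : ℝ) ^ (-(loopW S.1 + loopH S.1 + 2))

/-! ### Topology of the circle -/

lemma isPreconnected_sphere_diff_singleton (p : ℝ × ℝ) (hp : ‖p‖ = 1) :
    IsPreconnected (Metric.sphere (0 : ℝ × ℝ) 1 \ {p}) := by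
  have hp0 : p ≠ 0 := by rintro rfl; simp at hp
  set U : Set (ℝ × ℝ) := {x | ∀ t : ℝ, 0 ≤ t → x ≠ t • p} with hU
  have hstar : StarConvex ℝ (-p) U := by
    intro y hy a b ha hb hab t ht h
    rcases hb.eq_or_lt with rfl | hb
    · have : (t + a) • p = 0 := by
        rw [add_smul, ← h]; simp
      rcases smul_eq_zero.1 this with h1 | h1
      · have : a = 0 := by linarith
        subst this; norm_num at hab
      · exact hp0 h1
    · refine hy (b⁻¹ * (t + a)) (by positivity) ?_
      rw [mul_smul, add_smul, ← h]
      simp [smul_smul, hb.ne']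
  have hU0 : ∀ x ∈ U, x ≠ 0 := fun x hx h => hx 0 le_rfl (by simp [h])
  have hmem : -p ∈ U := by
    intro t ht h
    have : (t + 1) • p = 0 := by rw [add_smul, ← h]; simp
    rcases smul_eq_zero.1 this with h1 | h1
    · linarith
    · exact hp0 h1
  have hconn : IsPreconnected U := (hstar.isPathConnected hmem).isConnected.isPreconnected
  have hcont : ContinuousOn (fun x : ℝ × ℝ => ‖x‖⁻¹ • x) U := by
    refine ContinuousOn.smul (ContinuousOn.inv₀ continuous_norm.continuousOn ?_) continuousOn_id
    exact fun x hx => norm_ne_zero_iff.2 (hU0 x hx)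
  convert hconn.image _ hcont using 1
  ext x
  simp only [Set.mem_sdiff, mem_sphere_zero_iff_norm, Set.mem_singleton_iff, Set.mem_image]
  constructor
  · rintro ⟨hx, hxp⟩
    refine ⟨x, fun t ht h => hxp ?_, by simp [hx]⟩
    have : t = 1 := by
      have := congrArg norm h
      rwa [hx, norm_smul, hp, mul_one, Real.norm_of_nonneg ht, eq_comm] at this
    rw [h, this, one_smul]
  · rintro ⟨y, hy, rfl⟩
    have hy0 := norm_pos_iff.2 (hU0 y hy)
    refine ⟨by rw [norm_smul, norm_inv, norm_norm, inv_mul_cancel₀ hy0.ne'], fun h => ?_⟩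
    refine hy ‖y‖ hy0.le ?_
    rw [← h, smul_smul, mul_inv_cancel₀ hy0.ne', one_smul]

lemma isPreconnected_unit_sphere : IsPreconnected (Metric.sphere (0 : ℝ × ℝ) 1) := by
  have h1 := isPreconnected_sphere_diff_singleton (1, 0) (by simp)
  have h2 := isPreconnected_sphere_diff_singleton (-1, 0) (by simp)
  have h := h1.union ((0 : ℝ), (1 : ℝ)) (by simp) (by simp) h2
  convert h using 1
  ext x
  simp only [Set.mem_union, Set.mem_sdiff, Set.mem_singleton_iff]
  constructor
  · intro hx
    by_cases h : x = (1, 0)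
    · exact Or.inr ⟨hx, by rw [h]; norm_num⟩
    · exact Or.inl ⟨hx, h⟩
  · rintro (h | h) <;> exact h.1

lemma IsCircle.isPreconnected {C : Set (ℝ × ℝ)} (h : IsCircle C) : IsPreconnected C := by
  obtain ⟨e⟩ := h
  have hs : PreconnectedSpace (Metric.sphere (0 : ℝ × ℝ) 1) :=
    isPreconnected_iff_preconnectedSpace.1 isPreconnected_unit_sphere
  convert isPreconnected_univ.image (fun x => ((e.symm x : C) : ℝ × ℝ))
    (continuous_subtype_val.comp e.symm.continuous).continuousOn using 1
  ext x
  simp only [Set.image_univ, Set.mem_range]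
  exact ⟨fun hx => ⟨e ⟨x, hx⟩, by simp⟩, by rintro ⟨y, rfl⟩; exact (e.symm y).2⟩

lemma IsCircle.nonempty {C : Set (ℝ × ℝ)} (h : IsCircle C) : C.Nonempty := by
  obtain ⟨e⟩ := h
  exact ⟨_, (e.symm ⟨(1, 0), by simp⟩).2⟩

lemma IsCircle.isPreconnected_diff_singleton {C : Set (ℝ × ℝ)} (h : IsCircle C) (p : ℝ × ℝ) :
    IsPreconnected (C \ {p}) := by
  by_cases hp : p ∈ C
  · obtain ⟨e⟩ := h
    have hq := isPreconnected_sphere_diff_singleton (e ⟨p, hp⟩ : ℝ × ℝ)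
      (by simp)
    have hq' : IsPreconnected ({e ⟨p, hp⟩}ᶜ : Set (Metric.sphere (0 : ℝ × ℝ) 1)) := by
      rw [← Topology.IsInducing.subtypeVal.isPreconnected_image]
      convert hq using 1
      ext x
      simp only [Set.mem_image, Set.mem_compl_iff, Set.mem_singleton_iff, Set.mem_sdiff,
        Subtype.exists, exists_and_right, exists_eq_right, Subtype.ext_iff]
      exact ⟨fun ⟨a, b⟩ => ⟨a, b⟩, fun ⟨a, b⟩ => ⟨a, b⟩⟩
    have := hq'.image (fun x => ((e.symm x : C) : ℝ × ℝ))
      (continuous_subtype_val.comp e.symm.continuous).continuousOn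
    convert this using 1
    ext x
    simp only [Set.mem_sdiff, Set.mem_singleton_iff, Set.mem_image, Set.mem_compl_iff]
    constructor
    · rintro ⟨hx, hxp⟩
      exact ⟨e ⟨x, hx⟩, by simpa using hxp, by simp⟩
    · rintro ⟨y, hy, rfl⟩
      refine ⟨(e.symm y).2, fun h => hy ?_⟩
      rw [← e.apply_symm_apply y]
      congr 1
      exact Subtype.ext h
  · rw [Set.sdiff_singleton_eq_self hp]
    exact h.isPreconnected

lemma IsCircle.image_homeomorph {C : Set (ℝ × ℝ)} (h : IsCircle C) (e : ℝ × ℝ ≃ₜ ℝ × ℝ) :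
    IsCircle (e '' C) := by
  obtain ⟨f⟩ := h
  exact ⟨(e.image C).symm.trans f⟩

/-! ### Geometry of stitches -/

lemma Stitch.mem_seg_vert {i j : ℤ} {p : ℝ × ℝ} :
    p ∈ (Stitch.vert i j).seg ↔ p.1 = i ∧ (j : ℝ) ≤ p.2 ∧ p.2 ≤ j + 1 := by
  obtain ⟨x, y⟩ := p
  simp only [Stitch.seg, ← Prod.image_mk_segment_right, segment_eq_Icc (le_add_of_nonneg_right
    zero_le_one), Set.mem_image, Set.mem_Icc, Prod.mk.injEq]
  constructor
  · rintro ⟨z, hz, rfl, rfl⟩; exact ⟨rfl, hz⟩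
  · rintro ⟨rfl, h⟩; exact ⟨y, h, rfl, rfl⟩

lemma Stitch.mem_seg_horiz {i j : ℤ} {p : ℝ × ℝ} :
    p ∈ (Stitch.horiz i j).seg ↔ p.2 = j ∧ (i : ℝ) ≤ p.1 ∧ p.1 ≤ i + 1 := by
  obtain ⟨x, y⟩ := p
  simp only [Stitch.seg, ← Prod.image_mk_segment_left, segment_eq_Icc (le_add_of_nonneg_right
    zero_le_one), Set.mem_image, Set.mem_Icc, Prod.mk.injEq]
  constructor
  · rintro ⟨z, hz, rfl, rfl⟩; exact ⟨rfl, hz⟩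
  · rintro ⟨rfl, h⟩; exact ⟨x, h, rfl, rfl⟩

lemma Stitch.isClosed_seg (s : Stitch) : IsClosed s.seg := by
  cases s with
  | vert i j =>
    have : (Stitch.vert i j).seg = {(i : ℝ)} ×ˢ Set.Icc (j : ℝ) (j + 1) := by
      ext p; simp [Stitch.mem_seg_vert]
    rw [this]; exact isClosed_singleton.prod isClosed_Icc
  | horiz i j =>
    have : (Stitch.horiz i j).seg = Set.Icc (i : ℝ) (i + 1) ×ˢ {(j : ℝ)} := by
      ext p; simp [Stitch.mem_seg_horiz, and_comm]
    rw [this]; exact isClosed_Icc.prod isClosed_singleton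

/-- The south or west endpoint of a stitch. -/
def Stitch.src : Stitch → ℝ × ℝ
  | .vert i j => (i, j)
  | .horiz i j => (i, j)

/-- The north or east endpoint of a stitch. -/
def Stitch.tgt : Stitch → ℝ × ℝ
  | .vert i j => (i, j + 1)
  | .horiz i j => (i + 1, j)

/-- The midpoint of a stitch. -/
noncomputable def Stitch.mid : Stitch → ℝ × ℝ
  | .vert i j => (i, j + 1 / 2)
  | .horiz i j => (i + 1 / 2, j)

lemma Stitch.src_mem (s : Stitch) : s.src ∈ s.seg := by
  cases s <;> simp [Stitch.src, Stitch.mem_seg_vert, Stitch.mem_seg_horiz]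

lemma Stitch.tgt_mem (s : Stitch) : s.tgt ∈ s.seg := by
  cases s <;> simp [Stitch.tgt, Stitch.mem_seg_vert, Stitch.mem_seg_horiz]

lemma Stitch.src_ne_mid (s : Stitch) : s.src ≠ s.mid := by
  cases s <;> simp [Stitch.src, Stitch.mid]

lemma Stitch.tgt_ne_mid (s : Stitch) : s.tgt ≠ s.mid := by
  cases s <;> simp [Stitch.tgt, Stitch.mid]

lemma Stitch.dist_src_tgt (s : Stitch) : dist s.src s.tgt = 1 := by
  cases s <;> simp [Stitch.src, Stitch.tgt, Prod.dist_eq]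

lemma Stitch.dist_le_half_or {s : Stitch} {p : ℝ × ℝ} (hp : p ∈ s.seg) :
    dist p s.src ≤ 1 / 2 ∨ dist p s.tgt ≤ 1 / 2 := by
  cases s with
  | vert i j =>
    rw [Stitch.mem_seg_vert] at hp
    simp only [Stitch.src, Stitch.tgt, Prod.dist_eq, hp.1, dist_self, Real.dist_eq, max_le_iff,
      abs_le]
    rcases le_total p.2 (j + 1 / 2) with h | h
    · left; refine ⟨by norm_num, ?_, ?_⟩ <;> linarith
    · right; refine ⟨by norm_num, ?_, ?_⟩ <;> linarith
  | horiz i j =>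
    rw [Stitch.mem_seg_horiz] at hp
    simp only [Stitch.src, Stitch.tgt, Prod.dist_eq, hp.1, dist_self, Real.dist_eq, max_le_iff,
      abs_le]
    rcases le_total p.1 (i + 1 / 2) with h | h
    · left; refine ⟨⟨?_, ?_⟩, by norm_num⟩ <;> linarith
    · right; refine ⟨⟨?_, ?_⟩, by norm_num⟩ <;> linarith

lemma Stitch.eq_mid {s : Stitch} {p : ℝ × ℝ} (h1 : dist p s.src ≤ 1 / 2)
    (h2 : dist p s.tgt ≤ 1 / 2) (hp : p ∈ s.seg) : p = s.mid := by
  cases s with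
  | vert i j =>
    rw [Stitch.mem_seg_vert] at hp
    simp only [Stitch.src, Stitch.tgt, Prod.dist_eq, Real.dist_eq, max_le_iff, abs_le] at h1 h2
    refine Prod.ext hp.1 ?_
    simp only [Stitch.mid]
    linarith
  | horiz i j =>
    rw [Stitch.mem_seg_horiz] at hp
    simp only [Stitch.src, Stitch.tgt, Prod.dist_eq, Real.dist_eq, max_le_iff, abs_le] at h1 h2
    refine Prod.ext ?_ hp.1
    simp only [Stitch.mid]
    linarith

lemma Int.eq_or_eq_add_one_of_cast {k j : ℤ} (h1 : (j : ℝ) ≤ k) (h2 : (k : ℝ) ≤ j + 1) :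
    k = j ∨ k = j + 1 := by
  have h1 : j ≤ k := by exact_mod_cast h1
  have h2 : k ≤ j + 1 := by exact_mod_cast h2
  omega

lemma Stitch.eq_src_or_eq_tgt {s t : Stitch} (hst : t ≠ s) {p : ℝ × ℝ} (hs : p ∈ s.seg)
    (ht : p ∈ t.seg) : p = s.src ∨ p = s.tgt := by
  obtain ⟨x, y⟩ := p
  have key : ∀ a b : ℤ, a ≠ b → ∀ z : ℝ, (a : ℝ) ≤ z → z ≤ a + 1 → (b : ℝ) ≤ z → z ≤ b + 1 →
      z = a ∨ z = a + 1 := by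
    intro a b hab z h1 h2 h3 h4
    rcases lt_or_gt_of_ne hab with h | h
    · have : (a : ℝ) + 1 ≤ b := by exact_mod_cast h
      right; linarith
    · have : (b : ℝ) + 1 ≤ a := by exact_mod_cast h
      left; linarith
  cases s with
  | vert i j =>
    rw [Stitch.mem_seg_vert] at hs
    obtain ⟨rfl, h1, h2⟩ := hs
    suffices y = j ∨ y = j + 1 by simpa [Stitch.src, Stitch.tgt] using this
    cases t with
    | vert i' j' =>
      rw [Stitch.mem_seg_vert] at ht
      obtain ⟨h0, h3, h4⟩ := ht
      have h0 : i = i' := Int.cast_injective (α := ℝ) h0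
      subst h0
      exact key j j' (fun h => hst (by rw [h])) y h1 h2 h3 h4
    | horiz i' j' =>
      rw [Stitch.mem_seg_horiz] at ht
      obtain ⟨rfl, h3, h4⟩ := ht
      exact_mod_cast Int.eq_or_eq_add_one_of_cast h1 h2
  | horiz i j =>
    rw [Stitch.mem_seg_horiz] at hs
    obtain ⟨rfl, h1, h2⟩ := hs
    suffices x = i ∨ x = i + 1 by simpa [Stitch.src, Stitch.tgt] using this
    cases t with
    | horiz i' j' =>
      rw [Stitch.mem_seg_horiz] at ht
      obtain ⟨h0, h3, h4⟩ := ht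
      have h0 : j = j' := Int.cast_injective (α := ℝ) h0
      subst h0
      exact key i i' (fun h => hst (by rw [h])) x h1 h2 h3 h4
    | vert i' j' =>
      rw [Stitch.mem_seg_vert] at ht
      obtain ⟨rfl, h3, h4⟩ := ht
      exact_mod_cast Int.eq_or_eq_add_one_of_cast h1 h2

lemma mem_curveOf {S : Set Stitch} {p : ℝ × ℝ} : p ∈ curveOf S ↔ ∃ s ∈ S, p ∈ s.seg := by
  simp [curveOf]

lemma isClosed_curveOf (S : Finset Stitch) : IsClosed (curveOf (S : Set Stitch)) :=
  S.finite_toSet.isClosed_biUnion fun s _ => s.isClosed_seg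

/-- In a circle made of stitches, no endpoint of a stitch is a dead end. -/
lemma exists_stitch_ne_of_endpoint {S : Finset Stitch} (hS : IsCircle (curveOf (S : Set Stitch)))
    {s : Stitch} (hs : s ∈ S) {v : ℝ × ℝ} (hv : v = s.src ∨ v = s.tgt) :
    ∃ t ∈ S, t ≠ s ∧ v ∈ t.seg := by
  by_contra! hcon
  obtain ⟨w, hw, hwv, hvm, hwm, hor, hmid, heq, hvmem⟩ : ∃ w, w ∈ s.seg ∧ dist w v = 1 ∧
      v ≠ s.mid ∧ w ≠ s.mid ∧ (∀ p ∈ s.seg, dist p v ≤ 1 / 2 ∨ dist p w ≤ 1 / 2) ∧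
      (∀ p ∈ s.seg, dist p v ≤ 1 / 2 → dist p w ≤ 1 / 2 → p = s.mid) ∧
      (∀ t ≠ s, ∀ p ∈ s.seg, p ∈ t.seg → p = v ∨ p = w) ∧ v ∈ s.seg := by
    rcases hv with rfl | rfl
    · exact ⟨s.tgt, s.tgt_mem, by rw [dist_comm, s.dist_src_tgt], s.src_ne_mid, s.tgt_ne_mid,
        fun p hp => Stitch.dist_le_half_or hp, fun p hp h1 h2 => Stitch.eq_mid h1 h2 hp,
        fun t ht p hp hp' => Stitch.eq_src_or_eq_tgt ht hp hp', s.src_mem⟩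
    · exact ⟨s.src, s.src_mem, s.dist_src_tgt, s.tgt_ne_mid, s.src_ne_mid,
        fun p hp => (Stitch.dist_le_half_or hp).symm, fun p hp h1 h2 => Stitch.eq_mid h2 h1 hp,
        fun t ht p hp hp' => (Stitch.eq_src_or_eq_tgt ht hp hp').symm, s.tgt_mem⟩
  have hconn := isPreconnected_closed_iff.1 (hS.isPreconnected_diff_singleton s.mid)
    (s.seg ∩ Metric.closedBall v (1 / 2))
    (s.seg ∩ Metric.closedBall w (1 / 2) ∪ curveOf ((S.erase s : Finset Stitch) : Set Stitch))
    (s.isClosed_seg.inter Metric.isClosed_closedBall)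
    ((s.isClosed_seg.inter Metric.isClosed_closedBall).union (isClosed_curveOf _))
    (by
      rintro p ⟨hp, -⟩
      obtain ⟨t, ht, hpt⟩ := mem_curveOf.1 hp
      by_cases hts : t = s
      · subst hts
        rcases hor p hpt with h | h
        · exact Or.inl ⟨hpt, h⟩
        · exact Or.inr (Or.inl ⟨hpt, h⟩)
      · exact Or.inr (Or.inr (mem_curveOf.2 ⟨t, by simpa [hts] using ht, hpt⟩)))
    ⟨v, ⟨mem_curveOf.2 ⟨s, hs, hvmem⟩, hvm⟩, hvmem, by simp⟩
    ⟨w, ⟨mem_curveOf.2 ⟨s, hs, hw⟩, hwm⟩, Or.inl ⟨hw, by simp⟩⟩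
  obtain ⟨p, ⟨-, hpm⟩, ⟨hps, hpv⟩, ⟨-, hpw⟩ | hp⟩ := hconn
  · exact hpm (hmid p hps hpv hpw)
  · obtain ⟨t, ht, hpt⟩ := mem_curveOf.1 hp
    have ht : t ≠ s ∧ t ∈ S := Finset.mem_erase.1 ht
    rcases heq t ht.1 p hps hpt with rfl | rfl
    · exact hcon t ht.2 ht.1 hpt
    · rw [Metric.mem_closedBall, hwv] at hpv
      norm_num at hpv

/-! ### Stitches of a pattern -/

lemma Int.eq_of_cast_zmod_two {j j' : ℤ} (h : (j : ZMod 2) = j') {y : ℝ} (h1 : (j : ℝ) ≤ y)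
    (h2 : y ≤ j + 1) (h3 : (j' : ℝ) ≤ y) (h4 : y ≤ j' + 1) : j = j' := by
  have h := (ZMod.intCast_eq_intCast_iff j j' 2).1 h
  have h5 : j ≤ j' + 1 := by exact_mod_cast h1.trans h4
  have h6 : j' ≤ j + 1 := by exact_mod_cast h3.trans h2
  rw [Int.ModEq] at h
  omega

lemma Stitch.vert_eq {ε η : ℤ → ZMod 2} {i j i' j' : ℤ}
    (h : (Stitch.vert i j).InPattern ε η) (h' : (Stitch.vert i' j').InPattern ε η) {p : ℝ × ℝ}
    (hp : p ∈ (Stitch.vert i j).seg) (hp' : p ∈ (Stitch.vert i' j').seg) :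
    Stitch.vert i j = Stitch.vert i' j' := by
  rw [Stitch.mem_seg_vert] at hp hp'
  have hi : i = i' := by exact_mod_cast hp.1.symm.trans hp'.1
  subst hi
  rw [Int.eq_of_cast_zmod_two (Eq.trans h (Eq.symm h')) hp.2.1 hp.2.2 hp'.2.1 hp'.2.2]

lemma Stitch.horiz_eq {ε η : ℤ → ZMod 2} {i j i' j' : ℤ}
    (h : (Stitch.horiz i j).InPattern ε η) (h' : (Stitch.horiz i' j').InPattern ε η) {p : ℝ × ℝ}
    (hp : p ∈ (Stitch.horiz i j).seg) (hp' : p ∈ (Stitch.horiz i' j').seg) :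
    Stitch.horiz i j = Stitch.horiz i' j' := by
  rw [Stitch.mem_seg_horiz] at hp hp'
  have hi : j = j' := by exact_mod_cast hp.1.symm.trans hp'.1
  subst hi
  rw [Int.eq_of_cast_zmod_two (Eq.trans h (Eq.symm h')) hp.2.1 hp.2.2 hp'.2.1 hp'.2.2]

/-- At most two stitches of a pattern meet at a point. -/
lemma Stitch.eq_of_ne_of_ne {ε η : ℤ → ZMod 2} {s t u : Stitch} (hs : s.InPattern ε η)
    (ht : t.InPattern ε η) (hu : u.InPattern ε η) {p : ℝ × ℝ} (hps : p ∈ s.seg) (hpt : p ∈ t.seg)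
    (hpu : p ∈ u.seg) (hts : t ≠ s) (hus : u ≠ s) : t = u := by
  cases s <;> cases t <;> cases u <;>
  first
  | exact absurd (Stitch.vert_eq ht hs hpt hps) hts
  | exact absurd (Stitch.horiz_eq ht hs hpt hps) hts
  | exact absurd (Stitch.vert_eq hu hs hpu hps) hus
  | exact absurd (Stitch.horiz_eq hu hs hpu hps) hus
  | exact Stitch.vert_eq ht hu hpt hpu
  | exact Stitch.horiz_eq ht hu hpt hpu

/-- Two loops of the same pattern that share a stitch are equal. -/
lemma subset_of_mem_of_mem {ε η : ℤ → ZMod 2} {S T : Finset Stitch}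
    (hS : IsCircle (curveOf (S : Set Stitch))) (hT : IsCircle (curveOf (T : Set Stitch)))
    (hSp : ∀ s ∈ S, s.InPattern ε η) (hTp : ∀ s ∈ T, s.InPattern ε η) {s : Stitch}
    (hsS : s ∈ S) (hsT : s ∈ T) : S ⊆ T := by
  intro u huS
  by_contra huT
  obtain ⟨p, -, hp1, hp2⟩ := isPreconnected_closed_iff.1 hS.isPreconnected
    (curveOf ((S ∩ T : Finset Stitch) : Set Stitch)) (curveOf ((S \ T : Finset Stitch) : Set Stitch))
    (isClosed_curveOf _) (isClosed_curveOf _)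
    (by
      intro p hp
      obtain ⟨t, ht, hpt⟩ := mem_curveOf.1 hp
      have ht : t ∈ S := ht
      by_cases h : t ∈ T
      · exact Or.inl (mem_curveOf.2 ⟨t, by simp [h, ht], hpt⟩)
      · exact Or.inr (mem_curveOf.2 ⟨t, by simp [h, ht], hpt⟩))
    ⟨s.src, mem_curveOf.2 ⟨s, hsS, s.src_mem⟩,
      mem_curveOf.2 ⟨s, by simp [hsS, hsT], s.src_mem⟩⟩
    ⟨u.src, mem_curveOf.2 ⟨u, huS, u.src_mem⟩,
      mem_curveOf.2 ⟨u, by simp [huS, huT], u.src_mem⟩⟩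
  obtain ⟨a, ha, hpa⟩ := mem_curveOf.1 hp1
  obtain ⟨b, hb, hpb⟩ := mem_curveOf.1 hp2
  have ha : a ∈ S ∧ a ∈ T := by simpa using ha
  have hb : b ∈ S ∧ b ∉ T := by simpa using hb
  have hba : b ≠ a := by rintro rfl; exact hb.2 ha.2
  obtain ⟨t, htT, hta, hpt⟩ := exists_stitch_ne_of_endpoint hT ha.2
    (Stitch.eq_src_or_eq_tgt hba hpa hpb)
  have := Stitch.eq_of_ne_of_ne (hSp a ha.1) (hSp b hb.1) (hTp t htT) hpa hpb hpt hba hta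
  exact hb.2 (this ▸ htT)

/-! ### Extent of a loop -/

lemma isLeast_sInf_coord {S : Finset Stitch} (hS : S.Nonempty) (c : Stitch → ℤ) :
    IsLeast {x : ℤ | ∃ s ∈ S, x = c s} (sInf {x : ℤ | ∃ s ∈ S, x = c s}) := by
  have hfin : {x : ℤ | ∃ s ∈ S, x = c s}.Finite := by
    refine (S.image c).finite_toSet.subset ?_
    rintro x ⟨s, hs, rfl⟩
    simpa using ⟨s, hs, rfl⟩
  obtain ⟨s, hs⟩ := hS
  exact ⟨Int.csInf_mem ⟨_, s, hs, rfl⟩ hfin.bddBelow, fun x hx => csInf_le hfin.bddBelow hx⟩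

lemma isGreatest_sSup_coord {S : Finset Stitch} (hS : S.Nonempty) (c : Stitch → ℤ) :
    IsGreatest {x : ℤ | ∃ s ∈ S, x = c s} (sSup {x : ℤ | ∃ s ∈ S, x = c s}) := by
  have hfin : {x : ℤ | ∃ s ∈ S, x = c s}.Finite := by
    refine (S.image c).finite_toSet.subset ?_
    rintro x ⟨s, hs, rfl⟩
    simpa using ⟨s, hs, rfl⟩
  obtain ⟨s, hs⟩ := hS
  exact ⟨Int.csSup_mem ⟨_, s, hs, rfl⟩ hfin.bddAbove, fun x hx => le_csSup hfin.bddAbove hx⟩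

/-- The minimal x-coordinate of a set of stitches. -/
noncomputable def loopLeft (S : Finset Stitch) : ℤ := sInf {x : ℤ | ∃ s ∈ S, x = s.minX}

/-- The maximal x-coordinate of a set of stitches. -/
noncomputable def loopRight (S : Finset Stitch) : ℤ := sSup {x : ℤ | ∃ s ∈ S, x = s.maxX}

/-- The minimal y-coordinate of a set of stitches. -/
noncomputable def loopBottom (S : Finset Stitch) : ℤ := sInf {y : ℤ | ∃ s ∈ S, y = s.minY}

/-- The maximal y-coordinate of a set of stitches. -/
noncomputable def loopTop (S : Finset Stitch) : ℤ := sSup {y : ℤ | ∃ s ∈ S, y = s.maxY}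

lemma loopLeft_le {S : Finset Stitch} {s : Stitch} (hs : s ∈ S) : loopLeft S ≤ s.minX :=
  (isLeast_sInf_coord ⟨s, hs⟩ Stitch.minX).2 ⟨s, hs, rfl⟩

lemma le_loopRight {S : Finset Stitch} {s : Stitch} (hs : s ∈ S) : s.maxX ≤ loopRight S :=
  (isGreatest_sSup_coord ⟨s, hs⟩ Stitch.maxX).2 ⟨s, hs, rfl⟩

lemma loopBottom_le {S : Finset Stitch} {s : Stitch} (hs : s ∈ S) : loopBottom S ≤ s.minY :=
  (isLeast_sInf_coord ⟨s, hs⟩ Stitch.minY).2 ⟨s, hs, rfl⟩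

lemma le_loopTop {S : Finset Stitch} {s : Stitch} (hs : s ∈ S) : s.maxY ≤ loopTop S :=
  (isGreatest_sSup_coord ⟨s, hs⟩ Stitch.maxY).2 ⟨s, hs, rfl⟩

lemma loopLeft_le_loopRight {S : Finset Stitch} (hS : S.Nonempty) : loopLeft S ≤ loopRight S := by
  obtain ⟨s, hs⟩ := hS
  refine (loopLeft_le hs).trans (le_trans ?_ (le_loopRight hs))
  cases s <;> simp [Stitch.minX, Stitch.maxX]

lemma loopBottom_le_loopTop {S : Finset Stitch} (hS : S.Nonempty) : loopBottom S ≤ loopTop S := by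
  obtain ⟨s, hs⟩ := hS
  refine (loopBottom_le hs).trans (le_trans ?_ (le_loopTop hs))
  cases s <;> simp [Stitch.minY, Stitch.maxY]

/-- `S` is a hitomezashi loop of some pattern. -/
def IsLoop (S : Finset Stitch) : Prop :=
  IsCircle (curveOf (S : Set Stitch)) ∧ ∃ ε η : ℤ → ZMod 2, ∀ s ∈ S, s.InPattern ε η

lemma nonempty_of_isCircle {S : Finset Stitch} (hS : IsCircle (curveOf (S : Set Stitch))) :
    S.Nonempty := by
  obtain ⟨p, hp⟩ := hS.nonempty
  obtain ⟨s, hs, -⟩ := mem_curveOf.1 hp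
  exact ⟨s, hs⟩

lemma Stitch.src_fst (s : Stitch) : s.src.1 = s.minX := by cases s <;> rfl
lemma Stitch.src_snd (s : Stitch) : s.src.2 = s.minY := by cases s <;> rfl

lemma Stitch.tgt_fst (s : Stitch) : s.tgt.1 = s.maxX := by
  cases s <;> simp [Stitch.tgt, Stitch.maxX]

lemma Stitch.tgt_snd (s : Stitch) : s.tgt.2 = s.maxY := by
  cases s <;> simp [Stitch.tgt, Stitch.maxY]

/-- A loop has a stitch on every vertical line that it meets. -/
lemma exists_vert_mem {S : Finset Stitch} (hS : IsCircle (curveOf (S : Set Stitch)))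
    {ε η : ℤ → ZMod 2} (hp : ∀ s ∈ S, s.InPattern ε η) {i : ℤ} (h1 : loopLeft S ≤ i)
    (h2 : i ≤ loopRight S) : ∃ j, Stitch.vert i j ∈ S := by
  have hne := nonempty_of_isCircle hS
  obtain ⟨s, hs, (hsx : loopLeft S = s.minX)⟩ := (isLeast_sInf_coord hne Stitch.minX).1
  obtain ⟨t, ht, (htx : loopRight S = t.maxX)⟩ := (isGreatest_sSup_coord hne Stitch.maxX).1
  have hcon := (hS.isPreconnected.image Prod.fst continuous_fst.continuousOn).ordConnected
  obtain ⟨p, hpC, hpi⟩ := hcon.out ⟨s.src, mem_curveOf.2 ⟨s, hs, s.src_mem⟩, s.src_fst⟩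
    ⟨t.tgt, mem_curveOf.2 ⟨t, ht, t.tgt_mem⟩, t.tgt_fst⟩
    (show (i : ℝ) ∈ Set.Icc (s.minX : ℝ) t.maxX from
      ⟨by exact_mod_cast hsx ▸ h1, by exact_mod_cast htx ▸ h2⟩)
  obtain ⟨u, huS, hpu⟩ := mem_curveOf.1 hpC
  have hvert : ∀ v ∈ S, p ∈ v.seg → (∃ i' j, v = Stitch.vert i' j) → ∃ j, Stitch.vert i j ∈ S := by
    rintro _ hv hpv ⟨i', j, rfl⟩
    have : i = i' := Int.cast_injective (α := ℝ) (hpi.symm.trans (Stitch.mem_seg_vert.1 hpv).1)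
    exact ⟨j, this ▸ hv⟩
  cases u with
  | vert k l => exact hvert _ huS hpu ⟨_, _, rfl⟩
  | horiz k l =>
    obtain ⟨e1, e2, e3⟩ := Stitch.mem_seg_horiz.1 hpu
    rw [hpi] at e2 e3
    have hend : p = (Stitch.horiz k l).src ∨ p = (Stitch.horiz k l).tgt := by
      rcases Int.eq_or_eq_add_one_of_cast e2 e3 with rfl | rfl
      · exact Or.inl (Prod.ext hpi e1)
      · exact Or.inr (Prod.ext (by simpa [Stitch.tgt] using hpi) e1)
    obtain ⟨v, hv, hvu, hpv⟩ := exists_stitch_ne_of_endpoint hS huS hend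
    cases v with
    | vert k' l' => exact hvert _ hv hpv ⟨_, _, rfl⟩
    | horiz k' l' => exact absurd (Stitch.horiz_eq (hp _ hv) (hp _ huS) hpv hpu) hvu

/-- A loop has a stitch on every horizontal line that it meets. -/
lemma exists_horiz_mem {S : Finset Stitch} (hS : IsCircle (curveOf (S : Set Stitch)))
    {ε η : ℤ → ZMod 2} (hp : ∀ s ∈ S, s.InPattern ε η) {j : ℤ} (h1 : loopBottom S ≤ j)
    (h2 : j ≤ loopTop S) : ∃ i, Stitch.horiz i j ∈ S := by
  have hne := nonempty_of_isCircle hS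
  obtain ⟨s, hs, (hsx : loopBottom S = s.minY)⟩ := (isLeast_sInf_coord hne Stitch.minY).1
  obtain ⟨t, ht, (htx : loopTop S = t.maxY)⟩ := (isGreatest_sSup_coord hne Stitch.maxY).1
  have hcon := (hS.isPreconnected.image Prod.snd continuous_snd.continuousOn).ordConnected
  obtain ⟨p, hpC, hpi⟩ := hcon.out ⟨s.src, mem_curveOf.2 ⟨s, hs, s.src_mem⟩, s.src_snd⟩
    ⟨t.tgt, mem_curveOf.2 ⟨t, ht, t.tgt_mem⟩, t.tgt_snd⟩
    (show (j : ℝ) ∈ Set.Icc (s.minY : ℝ) t.maxY from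
      ⟨by exact_mod_cast hsx ▸ h1, by exact_mod_cast htx ▸ h2⟩)
  obtain ⟨u, huS, hpu⟩ := mem_curveOf.1 hpC
  have hhoriz : ∀ v ∈ S, p ∈ v.seg → (∃ i j', v = Stitch.horiz i j') →
      ∃ i, Stitch.horiz i j ∈ S := by
    rintro _ hv hpv ⟨i, j', rfl⟩
    have : j = j' := Int.cast_injective (α := ℝ) (hpi.symm.trans (Stitch.mem_seg_horiz.1 hpv).1)
    exact ⟨i, this ▸ hv⟩
  cases u with
  | horiz k l => exact hhoriz _ huS hpu ⟨_, _, rfl⟩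
  | vert k l =>
    obtain ⟨e1, e2, e3⟩ := Stitch.mem_seg_vert.1 hpu
    rw [hpi] at e2 e3
    have hend : p = (Stitch.vert k l).src ∨ p = (Stitch.vert k l).tgt := by
      rcases Int.eq_or_eq_add_one_of_cast e2 e3 with rfl | rfl
      · exact Or.inl (Prod.ext e1 hpi)
      · exact Or.inr (Prod.ext e1 (by simpa [Stitch.tgt] using hpi))
    obtain ⟨v, hv, hvu, hpv⟩ := exists_stitch_ne_of_endpoint hS huS hend
    cases v with
    | horiz k' l' => exact hhoriz _ hv hpv ⟨_, _, rfl⟩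
    | vert k' l' => exact absurd (Stitch.vert_eq (hp _ hv) (hp _ huS) hpv hpu) hvu

/-- A loop determines exactly the labels of the grid lines that it meets. -/
lemma forall_inPattern_iff {S : Finset Stitch} (hS : IsCircle (curveOf (S : Set Stitch)))
    {ε η : ℤ → ZMod 2} (hp : ∀ s ∈ S, s.InPattern ε η) (ε' η' : ℤ → ZMod 2) :
    (∀ s ∈ S, s.InPattern ε' η') ↔
      (∀ i, loopLeft S ≤ i → i ≤ loopRight S → ε' i = ε i) ∧
      (∀ j, loopBottom S ≤ j → j ≤ loopTop S → η' j = η j) := by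
  constructor
  · refine fun h => ⟨fun i h1 h2 => ?_, fun j h1 h2 => ?_⟩
    · obtain ⟨j, hj⟩ := exists_vert_mem hS hp h1 h2
      exact (Eq.symm (h _ hj)).trans (hp _ hj)
    · obtain ⟨i, hi⟩ := exists_horiz_mem hS hp h1 h2
      exact (Eq.symm (h _ hi)).trans (hp _ hi)
  · rintro ⟨h1, h2⟩ s hs
    cases s with
    | vert i j => exact Eq.trans (hp _ hs) (h1 i (loopLeft_le hs) (le_loopRight hs)).symm
    | horiz i j => exact Eq.trans (hp _ hs) (h2 j (loopBottom_le hs) (le_loopTop hs)).symm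

/-! ### Translations -/

/-- The translate of a stitch by `(a, b)`. -/
def Stitch.shift (a b : ℤ) : Stitch → Stitch
  | .vert i j => .vert (i + a) (j + b)
  | .horiz i j => .horiz (i + a) (j + b)

/-- The translate of a finite set of stitches by `(a, b)`. -/
def shiftSet (a b : ℤ) (S : Finset Stitch) : Finset Stitch := S.image (Stitch.shift a b)

lemma mem_shiftSet {a b : ℤ} {S : Finset Stitch} {s : Stitch} :
    s ∈ shiftSet a b S ↔ ∃ t ∈ S, t.shift a b = s := Finset.mem_image

lemma shiftSet_shiftSet (a b a' b' : ℤ) (S : Finset Stitch) :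
    shiftSet a b (shiftSet a' b' S) = shiftSet (a' + a) (b' + b) S := by
  rw [shiftSet, shiftSet, Finset.image_image, shiftSet]
  congr 1
  funext s
  cases s <;> simp [Stitch.shift, add_assoc]

lemma shiftSet_zero (S : Finset Stitch) : shiftSet 0 0 S = S := by
  have : Stitch.shift 0 0 = id := by
    funext s
    cases s <;> simp [Stitch.shift]
  rw [shiftSet, this, Finset.image_id]

lemma Stitch.mem_seg_shift {a b : ℤ} {s : Stitch} {p : ℝ × ℝ} :
    p ∈ (s.shift a b).seg ↔ p + -((a : ℝ), (b : ℝ)) ∈ s.seg := by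
  cases s with
  | vert i j =>
    simp only [Stitch.shift, Stitch.mem_seg_vert, Prod.fst_add, Prod.snd_add, Prod.fst_neg,
      Prod.snd_neg, Int.cast_add]
    constructor <;> rintro ⟨h1, h2, h3⟩ <;> refine ⟨?_, ?_, ?_⟩ <;> linarith
  | horiz i j =>
    simp only [Stitch.shift, Stitch.mem_seg_horiz, Prod.fst_add, Prod.snd_add, Prod.fst_neg,
      Prod.snd_neg, Int.cast_add]
    constructor <;> rintro ⟨h1, h2, h3⟩ <;> refine ⟨?_, ?_, ?_⟩ <;> linarith

lemma curveOf_shiftSet (a b : ℤ) (S : Finset Stitch) :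
    curveOf (shiftSet a b S : Set Stitch) =
      Homeomorph.addRight ((a : ℝ), (b : ℝ)) '' curveOf (S : Set Stitch) := by
  ext p
  rw [Homeomorph.image_eq_preimage_symm]
  simp only [mem_curveOf, Set.mem_preimage, Homeomorph.addRight_symm, Homeomorph.coe_addRight,
    Finset.mem_coe, mem_shiftSet]
  constructor
  · rintro ⟨_, ⟨t, ht, rfl⟩, hp⟩
    exact ⟨t, ht, Stitch.mem_seg_shift.1 hp⟩
  · rintro ⟨t, ht, hp⟩
    exact ⟨_, ⟨t, ht, rfl⟩, Stitch.mem_seg_shift.2 hp⟩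

lemma IsLoop.shiftSet {S : Finset Stitch} (hS : IsLoop S) (a b : ℤ) : IsLoop (shiftSet a b S) := by
  obtain ⟨hc, ε, η, hp⟩ := hS
  refine ⟨?_, fun i => ε (i - a) + b, fun j => η (j - b) + a, ?_⟩
  · rw [curveOf_shiftSet]
    exact hc.image_homeomorph _
  · intro s hs
    obtain ⟨t, ht, rfl⟩ := mem_shiftSet.1 hs
    have := hp t ht
    cases t <;> simp_all [Stitch.shift, Stitch.InPattern]

lemma coord_shiftSet {a b k : ℤ} {S : Finset Stitch} {c : Stitch → ℤ}
    (hc : ∀ s, c (s.shift a b) = c s + k) :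
    {x : ℤ | ∃ s ∈ shiftSet a b S, x = c s} = (fun x => x + k) '' {x : ℤ | ∃ s ∈ S, x = c s} := by
  ext x
  simp only [mem_shiftSet, Set.mem_ofPred_eq, Set.mem_image]
  constructor
  · rintro ⟨_, ⟨t, ht, rfl⟩, rfl⟩
    exact ⟨_, ⟨t, ht, rfl⟩, (hc t).symm⟩
  · rintro ⟨_, ⟨t, ht, rfl⟩, rfl⟩
    exact ⟨_, ⟨t, ht, rfl⟩, (hc t).symm⟩

lemma sInf_coord_shiftSet {a b k : ℤ} {S : Finset Stitch} (hS : S.Nonempty) {c : Stitch → ℤ}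
    (hc : ∀ s, c (s.shift a b) = c s + k) :
    sInf {x : ℤ | ∃ s ∈ shiftSet a b S, x = c s} = sInf {x : ℤ | ∃ s ∈ S, x = c s} + k := by
  rw [coord_shiftSet hc]
  exact ((monotone_id.add_const k).map_isLeast (isLeast_sInf_coord hS c)).csInf_eq

lemma sSup_coord_shiftSet {a b k : ℤ} {S : Finset Stitch} (hS : S.Nonempty) {c : Stitch → ℤ}
    (hc : ∀ s, c (s.shift a b) = c s + k) :
    sSup {x : ℤ | ∃ s ∈ shiftSet a b S, x = c s} = sSup {x : ℤ | ∃ s ∈ S, x = c s} + k := by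
  rw [coord_shiftSet hc]
  exact ((monotone_id.add_const k).map_isGreatest (isGreatest_sSup_coord hS c)).csSup_eq

lemma loopLeft_shiftSet {S : Finset Stitch} (hS : S.Nonempty) (a b : ℤ) :
    loopLeft (shiftSet a b S) = loopLeft S + a :=
  sInf_coord_shiftSet hS fun s => by cases s <;> simp [Stitch.shift, Stitch.minX]

lemma loopRight_shiftSet {S : Finset Stitch} (hS : S.Nonempty) (a b : ℤ) :
    loopRight (shiftSet a b S) = loopRight S + a :=
  sSup_coord_shiftSet hS fun s => by cases s <;> simp [Stitch.shift, Stitch.maxX]; ring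

lemma loopBottom_shiftSet {S : Finset Stitch} (hS : S.Nonempty) (a b : ℤ) :
    loopBottom (shiftSet a b S) = loopBottom S + b :=
  sInf_coord_shiftSet hS fun s => by cases s <;> simp [Stitch.shift, Stitch.minY]

lemma loopTop_shiftSet {S : Finset Stitch} (hS : S.Nonempty) (a b : ℤ) :
    loopTop (shiftSet a b S) = loopTop S + b :=
  sSup_coord_shiftSet hS fun s => by cases s <;> simp [Stitch.shift, Stitch.maxY]; ring

lemma loopW_eq (S : Finset Stitch) : loopW S = loopRight S - loopLeft S := rfl

lemma loopH_eq (S : Finset Stitch) : loopH S = loopTop S - loopBottom S := rfl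

lemma loopW_shiftSet {S : Finset Stitch} (hS : S.Nonempty) (a b : ℤ) :
    loopW (shiftSet a b S) = loopW S := by
  rw [loopW_eq, loopW_eq, loopLeft_shiftSet hS, loopRight_shiftSet hS]; ring

lemma loopH_shiftSet {S : Finset Stitch} (hS : S.Nonempty) (a b : ℤ) :
    loopH (shiftSet a b S) = loopH S := by
  rw [loopH_eq, loopH_eq, loopBottom_shiftSet hS, loopTop_shiftSet hS]; ring

lemma isNormLoop_iff {S : Finset Stitch} :
    IsNormLoop S ↔ IsLoop S ∧ loopLeft S = 0 ∧ loopBottom S = 0 :=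
  ⟨fun h => ⟨⟨h.2.1, h.1⟩, h.2.2.1, h.2.2.2⟩, fun h => ⟨h.1.2, h.1.1, h.2.1, h.2.2⟩⟩

lemma IsLoop.nonempty {S : Finset Stitch} (hS : IsLoop S) : S.Nonempty := nonempty_of_isCircle hS.1

lemma IsLoop.isNormLoop_shiftSet {S : Finset Stitch} (hS : IsLoop S) :
    IsNormLoop (_root_.shiftSet (-loopLeft S) (-loopBottom S) S) :=
  isNormLoop_iff.2 ⟨hS.shiftSet _ _, by rw [loopLeft_shiftSet hS.nonempty]; ring,
    by rw [loopBottom_shiftSet hS.nonempty]; ring⟩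

/-! ### Probability of a loop -/

lemma forall_inGrid_iff {S : Finset Stitch} (hS : S.Nonempty) (m n : ℕ) :
    (∀ s ∈ S, s.inGrid m n) ↔
      0 ≤ loopLeft S ∧ loopRight S ≤ n ∧ 0 ≤ loopBottom S ∧ loopTop S ≤ m := by
  constructor
  · intro h
    obtain ⟨s, hs, hsx⟩ := (isLeast_sInf_coord hS Stitch.minX).1
    obtain ⟨t, ht, htx⟩ := (isGreatest_sSup_coord hS Stitch.maxX).1
    obtain ⟨u, hu, hux⟩ := (isLeast_sInf_coord hS Stitch.minY).1
    obtain ⟨v, hv, hvx⟩ := (isGreatest_sSup_coord hS Stitch.maxY).1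
    rw [loopLeft, loopRight, loopBottom, loopTop, hsx, htx, hux, hvx]
    replace hs := h s hs
    replace ht := h t ht
    replace hu := h u hu
    replace hv := h v hv
    refine ⟨?_, ?_, ?_, ?_⟩
    · cases s <;> exact hs.1
    · cases t <;> exact ht.2.1
    · cases u <;> exact hu.2.2.1
    · cases v <;> exact hv.2.2.2
  · rintro ⟨h1, h2, h3, h4⟩ s hs
    have e1 := loopLeft_le hs
    have e2 := le_loopRight hs
    have e3 := loopBottom_le hs
    have e4 := le_loopTop hs
    cases s <;> simp only [Stitch.minX, Stitch.maxX, Stitch.minY, Stitch.maxY] at e1 e2 e3 e4 <;>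
      refine ⟨?_, ?_, ?_, ?_⟩ <;> omega

open Classical in
lemma card_extendLabels_eq (N : ℕ) (e : ℤ → ZMod 2) {a b : ℤ} (ha : 0 ≤ a) (hab : a ≤ b)
    (hb : b ≤ N) :
    ((Finset.univ.filter fun f : Fin (N + 1) → ZMod 2 =>
      ∀ i, a ≤ i → i ≤ b → extendLabels N f i = e i).card : ℝ) =
      2 ^ (N + 1) * (2 : ℝ) ^ (-(b - a + 1)) := by
  have hset : (Finset.univ.filter fun f : Fin (N + 1) → ZMod 2 =>
      ∀ i, a ≤ i → i ≤ b → extendLabels N f i = e i) =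
      Fintype.piFinset fun k : Fin (N + 1) =>
        if k ∈ Finset.Icc (⟨a.toNat, by omega⟩ : Fin (N + 1)) ⟨b.toNat, by omega⟩ then
          {e k} else Finset.univ := by
    ext f
    simp only [Finset.mem_filter, Finset.mem_univ, true_and, Fintype.mem_piFinset, Finset.mem_Icc,
      Fin.le_def]
    constructor
    · intro h k
      split_ifs with hk
      · have := h k (by omega) (by omega)
        rw [extendLabels, dif_pos ⟨by omega, by omega⟩] at this
        simpa using this
      · exact Finset.mem_univ _
    · intro h i h1 h2
      have := h ⟨i.toNat, by omega⟩
      rw [if_pos ⟨by simp only; omega, by simp only; omega⟩, Finset.mem_singleton] at this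
      rw [extendLabels, dif_pos ⟨by omega, by omega⟩, this]
      congr 1
      simp only; omega
  rw [hset, Fintype.card_piFinset]
  simp only [apply_ite Finset.card, Finset.card_singleton, Finset.card_univ, ZMod.card]
  rw [Finset.prod_ite, Finset.prod_const_one, one_mul, Finset.prod_const, Finset.filter_not,
    Finset.filter_mem_eq_inter, Finset.univ_inter, Finset.card_univ_sdiff, Fintype.card_fin,
    Fin.card_Icc]
  push_cast
  rw [← zpow_natCast, ← zpow_natCast, ← zpow_add₀ two_ne_zero]
  congr 1
  omega

/-- The weight `2^{-(width + height + 2)}` of a set of stitches. -/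
noncomputable def loopWeight (S : Finset Stitch) : ℝ := 2 ^ (-(loopW S + loopH S + 2))

lemma loopWeight_nonneg (S : Finset Stitch) : 0 ≤ loopWeight S := zpow_nonneg zero_le_two _

lemma loopWeight_shiftSet {S : Finset Stitch} (hS : S.Nonempty) (a b : ℤ) :
    loopWeight (shiftSet a b S) = loopWeight S := by
  rw [loopWeight, loopWeight, loopW_shiftSet hS, loopH_shiftSet hS]

open Classical in
/-- A fixed loop inside the grid belongs to the random pattern with probability
`2^{-(width + height + 2)}`. -/
lemma sum_inPattern_eq_loopWeight {m n : ℕ} {S : Finset Stitch} (hS : IsLoop S)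
    (hgrid : ∀ s ∈ S, s.inGrid m n) :
    ∑ f : Fin (n + 1) → ZMod 2, ∑ g : Fin (m + 1) → ZMod 2,
      (if ∀ s ∈ S, s.InPattern (extendLabels n f) (extendLabels m g) then (1 : ℝ) else 0) =
      2 ^ (m + n + 2) * loopWeight S := by
  have hne := hS.nonempty
  obtain ⟨h1, h2, h3, h4⟩ := (forall_inGrid_iff hne m n).1 hgrid
  obtain ⟨hc, ε, η, hp⟩ := hS
  have hite : ∀ (p q : Prop) [Decidable p] [Decidable q] [Decidable (p ∧ q)], (if p ∧ q then (1 : ℝ) else 0) =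
      (if p then 1 else 0) * (if q then 1 else 0) := by
    intro p q _ _ _
    by_cases hp : p <;> by_cases hq : q <;> simp [hp, hq]
  simp only [forall_inPattern_iff hc hp, hite]
  rw [← Finset.sum_mul_sum, Finset.sum_boole, Finset.sum_boole,
    card_extendLabels_eq n ε h1 (loopLeft_le_loopRight hne) h2,
    card_extendLabels_eq m η h3 (loopBottom_le_loopTop hne) h4, loopWeight, loopW_eq, loopH_eq,
    mul_mul_mul_comm, ← pow_add, ← zpow_add₀ two_ne_zero]
  congr 2 <;> ring

/-! ### Counting loops -/

/-- A finite set containing all stitches of the `m × n` grid. -/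
noncomputable def gridStitches (m n : ℕ) : Finset Stitch :=
  (Finset.Icc (0 : ℤ) n ×ˢ Finset.Icc (0 : ℤ) m).image (fun p => Stitch.vert p.1 p.2) ∪
  (Finset.Icc (0 : ℤ) n ×ˢ Finset.Icc (0 : ℤ) m).image (fun p => Stitch.horiz p.1 p.2)

lemma mem_gridStitches {m n : ℕ} {s : Stitch} (h : s.inGrid m n) : s ∈ gridStitches m n := by
  simp only [gridStitches, Finset.mem_union, Finset.mem_image, Finset.mem_product, Finset.mem_Icc]
  cases s with
  | vert i j =>
    obtain ⟨h1, h2, h3, h4⟩ := h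
    exact Or.inl ⟨(i, j), ⟨⟨h1, h2⟩, h3, by simp only; omega⟩, rfl⟩
  | horiz i j =>
    obtain ⟨h1, h2, h3, h4⟩ := h
    exact Or.inr ⟨(i, j), ⟨⟨h1, by simp only; omega⟩, h3, h4⟩, rfl⟩

lemma card_gridStitches_le (m n : ℕ) : (gridStitches m n).card ≤ 2 * ((n + 1) * (m + 1)) := by
  refine (Finset.card_union_le _ _).trans ?_
  have : (Finset.Icc (0 : ℤ) n ×ˢ Finset.Icc (0 : ℤ) m).card = (n + 1) * (m + 1) := by
    simp [Finset.card_product]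
  rw [two_mul, ← this]
  exact add_le_add Finset.card_image_le Finset.card_image_le

open Classical in
/-- The loops of all patterns that lie inside the `m × n` grid. -/
noncomputable def gridLoops (m n : ℕ) : Finset (Finset Stitch) :=
  (gridStitches m n).powerset.filter fun S => IsLoop S ∧ ∀ s ∈ S, s.inGrid m n

open Classical in
lemma mem_gridLoops {m n : ℕ} {S : Finset Stitch} :
    S ∈ gridLoops m n ↔ IsLoop S ∧ ∀ s ∈ S, s.inGrid m n := by
  rw [gridLoops, Finset.mem_filter, Finset.mem_powerset, and_iff_right_iff_imp]
  exact fun h s hs => mem_gridStitches (h.2 s hs)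

open Classical in
lemma loopsCount_eq (m n : ℕ) (ε η : ℤ → ZMod 2) :
    LoopsCount m n ε η =
      ((gridLoops m n).filter fun S => ∀ s ∈ S, s.InPattern ε η).card := by
  refine Nat.subtype_card _ fun S => ?_
  rw [Finset.mem_filter, mem_gridLoops]
  exact ⟨fun h => ⟨h.1.1.1, fun s hs => ⟨h.2 s hs, h.1.2 s hs⟩⟩,
    fun h => ⟨⟨⟨h.1, ε, η, fun s hs => (h.2 s hs).1⟩, fun s hs => (h.2 s hs).2⟩,
      fun s hs => (h.2 s hs).1⟩⟩

open Classical in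
lemma loopsCount_le (m n : ℕ) (ε η : ℤ → ZMod 2) :
    LoopsCount m n ε η ≤ 2 * ((n + 1) * (m + 1)) := by
  rw [loopsCount_eq]
  refine le_trans ?_ (card_gridStitches_le m n)
  set c : Finset Stitch → Stitch := fun S => if h : S.Nonempty then h.choose else .vert 0 0
  have hc : ∀ S : Finset Stitch, S.Nonempty → c S ∈ S := fun S h => by
    simp only [c, dif_pos h]
    exact h.choose_spec
  refine Finset.card_le_card_of_injOn c ?_ ?_
  · intro S hS
    obtain ⟨h1, -⟩ := Finset.mem_filter.1 hS
    rw [mem_gridLoops] at h1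
    exact mem_gridStitches (h1.2 _ (hc S h1.1.nonempty))
  · intro S hS T hT hST
    obtain ⟨h1, h2⟩ := Finset.mem_filter.1 hS
    obtain ⟨h3, h4⟩ := Finset.mem_filter.1 hT
    rw [mem_gridLoops] at h1 h3
    have hmS := hc S h1.1.nonempty
    have hmT := hc T h3.1.nonempty
    rw [hST] at hmS
    exact (subset_of_mem_of_mem h1.1.1 h3.1.1 h2 h4 hmS hmT).antisymm
      (subset_of_mem_of_mem h3.1.1 h1.1.1 h4 h2 hmT hmS)

lemma eLoops_le_card (m n : ℕ) : ELoops m n ≤ 2 * ((n + 1) * (m + 1)) := by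
  rw [ELoops, div_le_iff₀ (by positivity)]
  calc _ ≤ ∑ f : Fin (n + 1) → ZMod 2, ∑ g : Fin (m + 1) → ZMod 2,
        (2 * ((n + 1) * (m + 1)) : ℝ) :=
      Finset.sum_le_sum fun f _ => Finset.sum_le_sum fun g _ => by
        exact_mod_cast loopsCount_le m n _ _
    _ = _ := by
      simp only [Finset.sum_const, Finset.card_univ, Fintype.card_pi, ZMod.card,
        Finset.prod_const, Fintype.card_fin, nsmul_eq_mul]
      push_cast
      ring

lemma eLoops_eq_sum (m n : ℕ) : ELoops m n = ∑ S ∈ gridLoops m n, loopWeight S := by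
  classical
  rw [ELoops, div_eq_iff (by positivity), Finset.sum_mul]
  simp only [loopsCount_eq, Finset.card_filter, Nat.cast_sum, Nat.cast_ite, Nat.cast_one,
    Nat.cast_zero]
  simp_rw [Finset.sum_comm (s := Finset.univ) (t := gridLoops m n)]
  refine Finset.sum_congr rfl fun S hS => ?_
  rw [mem_gridLoops] at hS
  rw [sum_inPattern_eq_loopWeight hS.1 hS.2, mul_comm]

/-- Lower bound for the expectation from the translates of finitely many loops. -/
lemma sum_mul_le_eLoops (F : Finset {S : Finset Stitch // IsNormLoop S}) {K m n : ℕ}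
    (hW : ∀ L ∈ F, loopW L.1 ≤ K) (hH : ∀ L ∈ F, loopH L.1 ≤ K) :
    (∑ L ∈ F, loopWeight L.1) * (((n + 1 - K : ℕ) : ℝ) * ((m + 1 - K : ℕ) : ℝ)) ≤ ELoops m n := by
  classical
  set φ : {S : Finset Stitch // IsNormLoop S} × ℕ × ℕ → Finset Stitch :=
    fun p => shiftSet p.2.1 p.2.2 p.1.1
  have hne : ∀ L : {S : Finset Stitch // IsNormLoop S}, L.1.Nonempty :=
    fun L => (isNormLoop_iff.1 L.2).1.nonempty
  have hleft : ∀ p, loopLeft (φ p) = p.2.1 := fun p => by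
    rw [loopLeft_shiftSet (hne _), (isNormLoop_iff.1 p.1.2).2.1, zero_add]
  have hbot : ∀ p, loopBottom (φ p) = p.2.2 := fun p => by
    rw [loopBottom_shiftSet (hne _), (isNormLoop_iff.1 p.1.2).2.2, zero_add]
  have hinj : Function.Injective φ := by
    rintro ⟨L, a, b⟩ ⟨L', a', b'⟩ h
    have ha : (a : ℤ) = a' := by
      rw [← hleft (L, a, b), h, hleft]
    have hb : (b : ℤ) = b' := by
      rw [← hbot (L, a, b), h, hbot]
    have hL : L = L' := by
      have := congrArg (shiftSet (-(a : ℤ)) (-(b : ℤ))) h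
      simp only [φ, shiftSet_shiftSet, ha, hb, add_neg_cancel, shiftSet_zero] at this
      exact Subtype.ext this
    rw [hL, Nat.cast_injective ha, Nat.cast_injective hb]
  rw [eLoops_eq_sum]
  calc _ = ∑ p ∈ F ×ˢ (Finset.range (n + 1 - K) ×ˢ Finset.range (m + 1 - K)),
        loopWeight (φ p) := by
        rw [Finset.sum_product, Finset.sum_mul]
        refine Finset.sum_congr rfl fun L _ => ?_
        rw [Finset.sum_congr rfl fun x _ => loopWeight_shiftSet (hne L) _ _, Finset.sum_const,
          Finset.card_product, Finset.card_range, Finset.card_range, nsmul_eq_mul, mul_comm]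
        push_cast
        ring
    _ = ∑ S ∈ (F ×ˢ (Finset.range (n + 1 - K) ×ˢ Finset.range (m + 1 - K))).image φ,
        loopWeight S := (Finset.sum_image hinj.injOn).symm
    _ ≤ _ := by
        refine Finset.sum_le_sum_of_subset_of_nonneg ?_ fun S _ _ => loopWeight_nonneg S
        intro S hS
        obtain ⟨⟨L, a, b⟩, hp, rfl⟩ := Finset.mem_image.1 hS
        simp only [Finset.mem_product, Finset.mem_range] at hp
        obtain ⟨hL, ha, hb⟩ := hp
        have hloop : IsLoop (φ (L, a, b)) := (isNormLoop_iff.1 L.2).1.shiftSet _ _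
        refine mem_gridLoops.2 ⟨hloop, (forall_inGrid_iff hloop.nonempty m n).2 ?_⟩
        have e1 := hleft (L, a, b)
        have e2 := hbot (L, a, b)
        have e3 := loopW_shiftSet (hne L) a b
        have e4 := loopH_shiftSet (hne L) a b
        have e5 := loopW_eq (φ (L, a, b))
        have e6 := loopH_eq (φ (L, a, b))
        have e7 := hW L hL
        have e8 := hH L hL
        simp only [φ] at e1 e2 e5 e6 ⊢
        refine ⟨?_, ?_, ?_, ?_⟩ <;> omega

/-- The translate of a set of stitches whose minimal coordinates are `0`. -/
noncomputable def normalizeLoop (S : Finset Stitch) : Finset Stitch :=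
  shiftSet (-loopLeft S) (-loopBottom S) S

lemma sum_loopWeight_gridLoops_le (m n : ℕ) :
    ∑ S ∈ gridLoops m n, loopWeight S ≤
      (∑ L ∈ (gridLoops m n).image normalizeLoop, loopWeight L) * ((n + 1) * (m + 1)) := by
  have hloop : ∀ S ∈ gridLoops m n, IsLoop S := fun S hS => (mem_gridLoops.1 hS).1
  have hgrid := fun S (hS : S ∈ gridLoops m n) =>
    (forall_inGrid_iff (hloop S hS).nonempty m n).1 (mem_gridLoops.1 hS).2
  let ψ : Finset Stitch → Finset Stitch × ℕ × ℕ :=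
    fun S => (normalizeLoop S, (loopLeft S).toNat, (loopBottom S).toNat)
  have hinj : Set.InjOn ψ (gridLoops m n : Set (Finset Stitch)) := by
    intro S hS T hT h
    simp only [ψ, Prod.mk.injEq] at h
    obtain ⟨h1, h2, h3⟩ := h
    have hS := hgrid S hS
    have hT := hgrid T hT
    have e1 : loopLeft S = loopLeft T := by omega
    have e2 : loopBottom S = loopBottom T := by omega
    have := congrArg (shiftSet (loopLeft T) (loopBottom T)) h1
    simpa only [normalizeLoop, shiftSet_shiftSet, e1, e2, neg_add_cancel, shiftSet_zero] using this
  have h1 : ∑ S ∈ gridLoops m n, loopWeight S =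
      ∑ p ∈ (gridLoops m n).image ψ, loopWeight p.1 := by
    rw [Finset.sum_image hinj]
    exact Finset.sum_congr rfl fun S hS => (loopWeight_shiftSet (hloop S hS).nonempty _ _).symm
  have h2 : (gridLoops m n).image ψ ⊆ (gridLoops m n).image normalizeLoop ×ˢ
      (Finset.range (n + 1) ×ˢ Finset.range (m + 1)) := by
    intro p hp
    obtain ⟨S, hS, rfl⟩ := Finset.mem_image.1 hp
    have hS' := hgrid S hS
    have := loopLeft_le_loopRight (hloop S hS).nonempty
    have := loopBottom_le_loopTop (hloop S hS).nonempty
    simp only [ψ, Finset.mem_product, Finset.mem_range]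
    exact ⟨Finset.mem_image_of_mem _ hS, by omega, by omega⟩
  rw [h1]
  refine (Finset.sum_le_sum_of_subset_of_nonneg h2 fun p _ _ => loopWeight_nonneg _).trans_eq ?_
  rw [Finset.sum_product, Finset.sum_mul]
  refine Finset.sum_congr rfl fun L _ => ?_
  simp only [Finset.sum_const, Finset.card_product, Finset.card_range, nsmul_eq_mul]
  push_cast
  ring

lemma eLoops_le_loopConst_mul
    (hsum : Summable fun S : {S : Finset Stitch // IsNormLoop S} => loopWeight S.1) (m n : ℕ) :
    ELoops m n ≤ loopConst * ((n + 1) * (m + 1)) := by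
  classical
  rw [eLoops_eq_sum]
  refine (sum_loopWeight_gridLoops_le m n).trans ?_
  refine mul_le_mul_of_nonneg_right ?_ (by positivity)
  rw [← Finset.sum_subtype_of_mem (p := IsNormLoop) loopWeight]
  · exact hsum.sum_le_tsum _ fun L _ => loopWeight_nonneg _
  · intro L hL
    obtain ⟨S, hS, rfl⟩ := Finset.mem_image.1 hL
    exact (mem_gridLoops.1 hS).1.isNormLoop_shiftSet

lemma exists_bound_loopW_loopH (F : Finset {S : Finset Stitch // IsNormLoop S}) :
    ∃ K : ℕ, (∀ L ∈ F, loopW L.1 ≤ K) ∧ ∀ L ∈ F, loopH L.1 ≤ K := by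
  refine ⟨F.sup fun L => max (loopW L.1).toNat (loopH L.1).toNat, fun L hL => ?_, fun L hL => ?_⟩
  all_goals
    have := Finset.le_sup (f := fun L : {S : Finset Stitch // IsNormLoop S} =>
      max (loopW L.1).toNat (loopH L.1).toNat) hL
    omega

lemma sum_loopWeight_le (F : Finset {S : Finset Stitch // IsNormLoop S}) :
    ∑ L ∈ F, loopWeight L.1 ≤ 8 := by
  obtain ⟨K, hW, hH⟩ := exists_bound_loopW_loopH F
  have h := (sum_mul_le_eLoops F (m := 2 * K) (n := 2 * K) hW hH).trans (eLoops_le_card _ _)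
  rw [show 2 * K + 1 - K = K + 1 by omega] at h
  push_cast at h
  have hK : (0 : ℝ) ≤ K := K.cast_nonneg
  by_contra! hlt
  nlinarith [mul_lt_mul_of_pos_right hlt (show (0 : ℝ) < (K + 1) * (K + 1) by positivity)]

/-- The sum `c = Σ_{L ∈ 𝐋} 2^{-(width(L)+height(L)+2)}` over
hitomezashi loops modulo translation converges, and as `min {m, n} → ∞`, the expected
number of loops in the random `m × n` hitomezashi pattern satisfies
`E[Loops(H_{1/2}(m,n))] = (c + o(1)) · m · n`. -/
theorem hitomezashi_expected_loops :
    Summable (fun S : {S : Finset Stitch // IsNormLoop S} =>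
      (2 : ℝ) ^ (-(loopW S.1 + loopH S.1 + 2))) ∧
    ∀ δ : ℝ, 0 < δ → ∃ N : ℕ, ∀ m n : ℕ, N ≤ m → N ≤ n →
      |ELoops m n - loopConst * (m * n)| ≤ δ * (m * n) := by
  have hsum : Summable fun S : {S : Finset Stitch // IsNormLoop S} => loopWeight S.1 :=
    summable_of_sum_le (fun L => loopWeight_nonneg L.1) sum_loopWeight_le
  refine ⟨hsum, fun δ hδ => ?_⟩
  have hc8 : loopConst ≤ 8 := hsum.tsum_le_of_sum_le sum_loopWeight_le
  obtain ⟨F, hF⟩ : ∃ F : Finset {S : Finset Stitch // IsNormLoop S},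
      loopConst - δ / 2 < ∑ L ∈ F, loopWeight L.1 :=
    (hsum.hasSum.eventually (lt_mem_nhds (sub_lt_self loopConst (half_pos hδ)))).exists
  have hF0 : 0 ≤ ∑ L ∈ F, loopWeight L.1 := Finset.sum_nonneg fun L _ => loopWeight_nonneg L.1
  have hF8 := sum_loopWeight_le F
  obtain ⟨K, hW, hH⟩ := exists_bound_loopW_loopH F
  obtain ⟨N, hN⟩ := exists_nat_ge ((32 * K + 24) / δ)
  rw [div_le_iff₀ hδ] at hN
  refine ⟨max N (K + 1), fun m n hm hn => ?_⟩
  have hup := eLoops_le_loopConst_mul hsum m n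
  have hlow := sum_mul_le_eLoops F (m := m) (n := n) hW hH
  have hmK : K + 1 ≤ m := (le_max_right _ _).trans hm
  have hnK : K + 1 ≤ n := (le_max_right _ _).trans hn
  have hmN : (N : ℝ) ≤ m := by exact_mod_cast (le_max_left _ _).trans hm
  have hnN : (N : ℝ) ≤ n := by exact_mod_cast (le_max_left _ _).trans hn
  rw [Nat.cast_sub (by omega), Nat.cast_sub (by omega)] at hlow
  push_cast at hlow
  have hmK' : (K : ℝ) + 1 ≤ m := by exact_mod_cast hmK
  have hnK' : (K : ℝ) + 1 ≤ n := by exact_mod_cast hnK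
  have hK : (0 : ℝ) ≤ K := K.cast_nonneg
  have hδm : 32 * K + 24 ≤ δ * m := hN.trans (by rw [mul_comm]; gcongr)
  have hδn : 32 * K + 24 ≤ δ * n := hN.trans (by rw [mul_comm]; gcongr)
  have hmn : (32 * K + 24) * (n : ℝ) ≤ δ * (m * n) := by
    rw [← mul_assoc]; gcongr
  have hnm : (32 * K + 24) * (m : ℝ) ≤ δ * (m * n) := by
    rw [mul_comm (m : ℝ) n, ← mul_assoc]; gcongr
  rw [abs_le]
  constructor
  · set A := ∑ L ∈ F, loopWeight L.1
    have h1 : A * (m * n) - A * (K * (m + n)) ≤ ELoops m n := by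
      refine le_trans ?_ hlow
      rw [← mul_sub]
      refine mul_le_mul_of_nonneg_left ?_ hF0
      nlinarith
    have h2 : A * (K * (m + n)) ≤ 8 * (K * (m + n)) := by gcongr
    have h3 : (loopConst - δ / 2) * (m * n) ≤ A * (m * n) := by gcongr
    nlinarith
  · have h1 : loopConst * (n + m + 1) ≤ 8 * (n + m + 1) := by gcongr
    nlinarith [mul_nonneg hK (show (0 : ℝ) ≤ n by linarith),
      mul_nonneg hK (show (0 : ℝ) ≤ m by linarith)]
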